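/- Let t_i be a sequence of real numbers with t_i → ∞. The following are equivalent: (1) for every compact set K ⊆ X, one has g_{t_i}φ_{a,b}(s)·x₀ ∉ K for all s ∈ I, for all sufficiently large i; (2) there exists ε > 0 such that for every compact set K ⊆ X, (g_{t_i}λ_{a,b})(K) ≤ 1−ε for all sufficiently large i; (3) there exist vectors v_i ∈ ℤ³ \ {0} such that sup_{s∈I} ‖g_{t_i}φ_{a,b}(s)v_i‖ → 0 as i → ∞. -/

import Mathlib

open MeasureTheory Matrix Filter Topology ENNReal

noncomputable section

/-- `G = SL(3,ℝ)`. -/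
abbrev G : Type := Matrix.SpecialLinearGroup (Fin 3) ℝ

instance : TopologicalSpace G :=
  TopologicalSpace.induced (fun g : G => (g : Matrix (Fin 3) (Fin 3) ℝ)) inferInstance

/-- `Γ = SL(3,ℤ)`, viewed as a (discrete) subgroup of `G`. -/
def Gamma : Subgroup G := (Matrix.SpecialLinearGroup.map (n := Fin 3) (Int.castRingHom ℝ)).range

/-- `X = G/Γ` with the quotient topology. -/
abbrev X : Type := G ⧸ Gamma

instance : MeasurableSpace X := borel X

/-- `x₀ = eΓ ∈ X`. -/
def x₀ : X := ↑(1 : G)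

/-- `g_t = diag(e^{2t}, e^{-t}, e^{-t})`. -/
def gSL (t : ℝ) : G :=
  ⟨Matrix.diagonal ![Real.exp (2*t), Real.exp (-t), Real.exp (-t)], by
    rw [Matrix.det_diagonal, Fin.prod_univ_three]
    simp [← Real.exp_add]
    ring_nf⟩

/-- `φ_{a,b}(s)`, the unipotent matrix with first row `(1, s, as+b)`. -/
def phiSL (a b s : ℝ) : G :=
  ⟨!![1, s, a*s+b; 0, 1, 0; 0, 0, 1], by
    simp [Matrix.det_fin_three, Matrix.vecHead, Matrix.vecTail]⟩

/-- `λ_{a,b}` : the push-forward of the normalized Lebesgue measure on `I = [s₁,s₂]`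
under `s ↦ φ_{a,b}(s)·x₀`. -/
def lambdaAB (a b s₁ s₂ : ℝ) : Measure X :=
  Measure.map (fun s => phiSL a b s • x₀)
    ((volume (Set.Icc s₁ s₂))⁻¹ • volume.restrict (Set.Icc s₁ s₂))

/-- `g_t λ_{a,b}` : the translate of `λ_{a,b}` by `g_t`. -/
def gtLambda (a b s₁ s₂ t : ℝ) : Measure X :=
  Measure.map (fun x => gSL t • x) (lambdaAB a b s₁ s₂)

/-- `sup_{s ∈ [s₁,s₂]} ‖g_t φ_{a,b}(s) v‖` for an integer vector `v`, where `ℝ³`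
carries the supremum norm and matrices act by matrix–vector multiplication. -/
def supNormOrbit (a b s₁ s₂ t : ℝ) (v : Fin 3 → ℤ) : ℝ :=
  ⨆ s : Set.Icc s₁ s₂,
    ‖((gSL t * phiSL a b (s : ℝ) : G) : Matrix (Fin 3) (Fin 3) ℝ).mulVec
        (fun i => (v i : ℝ))‖


lemma pack {ι : Type*} [Countable ι] (z r : ι → ℝ) (κ lo hi : ℝ) (hκ : 0 ≤ κ) (S : Set ℝ)
    (hS : S ⊆ ⋃ i, Metric.closedBall (z i) (κ * r i))
    (hd : Pairwise (fun i j => Disjoint (Metric.ball (z i) (r i)) (Metric.ball (z j) (r j))))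
    (hsub : ∀ i, Metric.ball (z i) (r i) ⊆ Set.Icc lo hi) :
    volume S ≤ ENNReal.ofReal (κ * (hi - lo)) := by
  calc volume S ≤ volume (⋃ i, Metric.closedBall (z i) (κ * r i)) := measure_mono hS
    _ ≤ ∑' i, volume (Metric.closedBall (z i) (κ * r i)) := measure_iUnion_le _
    _ = ∑' i, ENNReal.ofReal κ * volume (Metric.ball (z i) (r i)) := by
        congr 1; ext i
        rw [Real.volume_closedBall, Real.volume_ball, ← ENNReal.ofReal_mul hκ]
        ring_nf
    _ = ENNReal.ofReal κ * volume (⋃ i, Metric.ball (z i) (r i)) := by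
        rw [ENNReal.tsum_mul_left, measure_iUnion hd (fun i => measurableSet_ball)]
    _ ≤ ENNReal.ofReal κ * volume (Set.Icc lo hi) := by
        gcongr; exact Set.iUnion_subset hsub
    _ = _ := by rw [Real.volume_Icc, ENNReal.ofReal_mul hκ]

lemma rot (c q η s₁ s₂ : ℝ) (hq : 1 ≤ |q|) (h0 : 0 ≤ η) (h1 : η ≤ 1/2) :
    volume {s | s ∈ Set.Icc s₁ s₂ ∧ ∃ n : ℤ, |n + c + q * s| < η} ≤
      ENNReal.ofReal (2 * η * ((s₂ - s₁) + 2)) := by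
  have hqp : 0 < |q| := by linarith
  have hq0 : q ≠ 0 := abs_pos.1 hqp
  have key : ∀ (n : ℤ) (s : ℝ), |n + c + q * s| = |q| * |s - (-(n + c) / q)| := by
    intro n s
    rw [← abs_mul]; congr 1; field_simp; ring
  have hinv : (|q|)⁻¹ ≤ 1 := inv_le_one_of_one_le₀ hq
  have hinvp : 0 < (|q|)⁻¹ := by positivity
  have := pack (ι := {n : ℤ // ∃ s ∈ Set.Icc s₁ s₂, |n + c + q * s| < η})
    (fun n => -(n.1 + c) / q) (fun n => (|q|)⁻¹ / 2) (2 * η) (s₁ - 1) (s₂ + 1) (by linarith)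
    {s | s ∈ Set.Icc s₁ s₂ ∧ ∃ n : ℤ, |n + c + q * s| < η} ?_ ?_ ?_
  · convert this using 2; ring
  · rintro s ⟨hs, n, hn⟩
    refine Set.mem_iUnion.2 ⟨⟨n, s, hs, hn⟩, ?_⟩
    rw [Metric.mem_closedBall, Real.dist_eq]
    rw [key] at hn
    have : |s - (-(n + c) / q)| < η * |q|⁻¹ := by
      rw [← div_eq_mul_inv, lt_div_iff₀ hqp]; linarith
    simp only; linarith
  · rintro ⟨n, _⟩ ⟨m, _⟩ hnm
    have hnm' : n ≠ m := fun h => hnm (Subtype.ext h)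
    apply Metric.ball_disjoint_ball
    rw [Real.dist_eq]
    have e : -((n:ℝ) + c) / q - -((m:ℝ) + c) / q = ((m - n : ℤ) : ℝ) / q := by
      push_cast; field_simp; ring
    simp only [e]
    rw [abs_div, div_eq_mul_inv |((m - n : ℤ) : ℝ)|]
    have : (1:ℝ) ≤ |((m - n : ℤ) : ℝ)| := by
      rw [← Int.cast_abs]; exact_mod_cast Int.one_le_abs (sub_ne_zero.2 hnm'.symm)
    nlinarith
  · rintro ⟨n, s, ⟨hs1, hs2⟩, hn⟩ x hx
    rw [Metric.mem_ball, Real.dist_eq] at hx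
    rw [key] at hn
    have h3 : |s - (-(n + c) / q)| < η * |q|⁻¹ := by
      rw [← div_eq_mul_inv, lt_div_iff₀ hqp]; linarith
    simp only at hx
    have h4 : η * |q|⁻¹ ≤ 1/2 := by nlinarith
    rw [abs_lt] at hx h3
    constructor <;> linarith

/-- first coordinate form -/
def Lf (a b : ℝ) (v : Fin 3 → ℤ) (s : ℝ) : ℝ := v 0 + s * v 1 + (a * s + b) * v 2

def Sh (a b δ T : ℝ) (v : Fin 3 → ℤ) (s : ℝ) : Prop :=
  |Lf a b v s| < δ / T ^ 2 ∧ |(v 1 : ℝ)| < δ * T ∧ |(v 2 : ℝ)| < δ * T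

lemma box_card (R : ℝ) (hR : 1 ≤ R) : ∃ B : Finset ℤ, (B.card : ℝ) ≤ 3 * R ∧
    ∀ n : ℤ, |(n : ℝ)| < R → n ∈ B := by
  refine ⟨Finset.Icc (-⌊R⌋) ⌊R⌋, ?_, ?_⟩
  · have h0 : 0 ≤ ⌊R⌋ := Int.floor_nonneg.2 (by linarith)
    rw [Int.card_Icc]
    have : (((⌊R⌋ + 1 - -⌊R⌋).toNat : ℕ) : ℝ) = ((⌊R⌋ + 1 - -⌊R⌋ : ℤ) : ℝ) := by
      exact_mod_cast congrArg (Int.cast (R := ℝ)) (Int.toNat_of_nonneg (by omega))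
    rw [this]; push_cast
    linarith [Int.floor_le R]
  · intro n hn
    rw [abs_lt] at hn
    rw [Finset.mem_Icc]
    constructor
    · have : -n ≤ ⌊R⌋ := Int.le_floor.2 (by push_cast; linarith)
      omega
    · exact Int.le_floor.2 hn.2.le

/-- large slope -/
lemma largeSlope (a b δ T s₁ s₂ : ℝ) (h : s₁ < s₂) (hδ : 0 < δ) (hδ' : δ ≤ 1/2) (hT : 1 ≤ T)
    (hδT : 1 ≤ δ * T) :
    volume {s | s ∈ Set.Icc s₁ s₂ ∧ ∃ v : Fin 3 → ℤ, Sh a b δ T v s ∧ 1 ≤ |(v 1 : ℝ) + a * v 2|} ≤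
      ENNReal.ofReal (18 * δ ^ 3 * ((s₂ - s₁) + 2)) := by
  obtain ⟨B, hB, hB'⟩ := box_card (δ * T) hδT
  have hη : δ / T ^ 2 ≤ 1 / 2 := by
    rw [div_le_iff₀ (by positivity)]; nlinarith
  have hsub : {s | s ∈ Set.Icc s₁ s₂ ∧ ∃ v : Fin 3 → ℤ, Sh a b δ T v s ∧ 1 ≤ |(v 1 : ℝ) + a * v 2|} ⊆
      ⋃ p ∈ (B ×ˢ B).filter (fun p => 1 ≤ |(p.1 : ℝ) + a * p.2|), {s | s ∈ Set.Icc s₁ s₂ ∧ ∃ n : ℤ, |n + b * p.2 + (p.1 + a * p.2) * s| < δ / T ^ 2} := by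
    rintro s ⟨hs, v, ⟨h1, h2, h3⟩, h4⟩
    simp only [Set.mem_iUnion]
    refine ⟨(v 1, v 2), ?_, hs, v 0, ?_⟩
    · simp [hB' _ h2, hB' _ h3, h4]
    · convert h1 using 2; simp only [Lf]; ring
  calc _ ≤ _ := measure_mono hsub
    _ ≤ ∑ p ∈ (B ×ˢ B).filter (fun p => 1 ≤ |(p.1 : ℝ) + a * p.2|), volume {s | s ∈ Set.Icc s₁ s₂ ∧ ∃ n : ℤ, |n + b * p.2 + (p.1 + a * p.2) * s| < δ / T ^ 2} := measure_biUnion_finset_le _ _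
    _ ≤ ∑ p ∈ (B ×ˢ B).filter (fun p => 1 ≤ |(p.1 : ℝ) + a * p.2|), ENNReal.ofReal (2 * (δ / T ^ 2) * ((s₂ - s₁) + 2)) := by
        apply Finset.sum_le_sum
        intro p hp
        exact rot _ _ _ _ _ (Finset.mem_filter.1 hp).2 (by positivity) hη
    _ ≤ ∑ p ∈ (B ×ˢ B), ENNReal.ofReal (2 * (δ / T ^ 2) * ((s₂ - s₁) + 2)) :=
        Finset.sum_le_sum_of_subset (Finset.filter_subset _ _)
    _ = ENNReal.ofReal (B.card * B.card * (2 * (δ / T ^ 2) * ((s₂ - s₁) + 2))) := by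
        rw [Finset.sum_const, Finset.card_product, nsmul_eq_mul, ← Nat.cast_mul, ENNReal.ofReal_mul (Nat.cast_nonneg _),
          ENNReal.ofReal_natCast]
    _ ≤ _ := by
        apply ENNReal.ofReal_le_ofReal
        have : (B.card * B.card : ℝ) ≤ (3 * (δ * T)) * (3 * (δ * T)) := by gcongr
        have h5 : 0 ≤ (2 * (δ / T ^ 2) * ((s₂ - s₁) + 2)) := by
          have : 0 < s₂ - s₁ + 2 := by linarith
          positivity
        refine (mul_le_mul_of_nonneg_right this h5).trans (le_of_eq ?_)
        field_simp; ring

def Pl (δ ρ T : ℝ) (s : ℝ) : Prop :=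
  ∃ u n : ℤ, u ≠ 0 ∧ |(u : ℝ)| < 2 * δ * T ∧ |n + (u : ℝ) * s| < 4 * ρ * δ / T

lemma planes (δ ρ T s₁ s₂ : ℝ) (h : s₁ < s₂) (hδ : 0 < δ) (hδ' : δ ≤ 1/2) (hρ : 0 < ρ)
    (hρ' : ρ ≤ 1/10) (hT : 1 ≤ T) (hδT : 1 ≤ δ * T) :
    volume {s | s ∈ Set.Icc s₁ s₂ ∧ Pl δ ρ T s} ≤
      ENNReal.ofReal (48 * ρ * δ ^ 2 * ((s₂ - s₁) + 2)) := by
  obtain ⟨B, hB, hB'⟩ := box_card (2 * δ * T) (by linarith)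
  have hη : 4 * ρ * δ / T ≤ 1 / 2 := by
    rw [div_le_iff₀ (by positivity)]; nlinarith
  have hsub : {s | s ∈ Set.Icc s₁ s₂ ∧ Pl δ ρ T s} ⊆
      ⋃ p ∈ B.filter (fun p => p ≠ 0), {s | s ∈ Set.Icc s₁ s₂ ∧ ∃ n : ℤ, |n + 0 + (p : ℝ) * s| < 4 * ρ * δ / T} := by
    rintro s ⟨hs, u, n, h1, h2, h3⟩
    simp only [Set.mem_iUnion]
    refine ⟨u, ?_, hs, n, ?_⟩
    · simp [hB' _ h2, h1]
    · simpa using h3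
  calc _ ≤ _ := measure_mono hsub
    _ ≤ ∑ p ∈ B.filter (fun p => p ≠ 0), volume {s | s ∈ Set.Icc s₁ s₂ ∧ ∃ n : ℤ, |n + 0 + (p : ℝ) * s| < 4 * ρ * δ / T} := measure_biUnion_finset_le _ _
    _ ≤ ∑ p ∈ B.filter (fun p => p ≠ 0), ENNReal.ofReal (2 * (4 * ρ * δ / T) * ((s₂ - s₁) + 2)) := by
        apply Finset.sum_le_sum
        intro p hp
        refine rot _ _ _ _ _ ?_ (by positivity) hη
        rw [← Int.cast_abs]; exact_mod_cast Int.one_le_abs (Finset.mem_filter.1 hp).2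
    _ ≤ ∑ p ∈ B, ENNReal.ofReal (2 * (4 * ρ * δ / T) * ((s₂ - s₁) + 2)) :=
        Finset.sum_le_sum_of_subset (Finset.filter_subset _ _)
    _ = ENNReal.ofReal (B.card * (2 * (4 * ρ * δ / T) * ((s₂ - s₁) + 2))) := by
        rw [Finset.sum_const, nsmul_eq_mul, ENNReal.ofReal_mul (Nat.cast_nonneg _),
          ENNReal.ofReal_natCast]
    _ ≤ _ := by
        apply ENNReal.ofReal_le_ofReal
        have h5 : 0 ≤ (2 * (4 * ρ * δ / T) * ((s₂ - s₁) + 2)) := by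
          have : 0 < s₂ - s₁ + 2 := by linarith
          positivity
        refine (mul_le_mul_of_nonneg_right hB h5).trans (le_of_eq ?_)
        field_simp; ring

def Prim (v : Fin 3 → ℤ) : Prop := ∃ c : Fin 3 → ℤ, c 0 * v 0 + c 1 * v 1 + c 2 * v 2 = 1

lemma exists_prim (w : Fin 3 → ℤ) (hw : w ≠ 0) : ∃ (v : Fin 3 → ℤ) (d : ℤ), Prim v ∧ d ≠ 0 ∧
    ∀ i, w i = d * v i := by
  set g : ℤ := ((Int.gcd (w 0) (Int.gcd (w 1) (w 2)) : ℕ) : ℤ) with hg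
  have e1 : g = w 0 * Int.gcdA (w 0) (Int.gcd (w 1) (w 2)) + (Int.gcd (w 1) (w 2)) * Int.gcdB (w 0) (Int.gcd (w 1) (w 2)) := Int.gcd_eq_gcd_ab _ _
  have e2 := Int.gcd_eq_gcd_ab (w 1) (w 2)
  have d0 : g ∣ w 0 := Int.gcd_dvd_left ..
  have d12 : g ∣ (Int.gcd (w 1) (w 2) : ℤ) := Int.gcd_dvd_right ..
  have d1 : g ∣ w 1 := d12.trans (Int.gcd_dvd_left ..)
  have d2 : g ∣ w 2 := d12.trans (Int.gcd_dvd_right ..)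
  have hg0 : g ≠ 0 := by
    intro h0
    rw [h0, zero_dvd_iff] at d0 d1 d2
    apply hw; ext i; fin_cases i <;> assumption
  obtain ⟨x, hx⟩ := d0
  obtain ⟨y, hy⟩ := d1
  obtain ⟨z, hz⟩ := d2
  refine ⟨![x, y, z], g, ⟨![Int.gcdA (w 0) (Int.gcd (w 1) (w 2)), Int.gcdB (w 0) (Int.gcd (w 1) (w 2)) * Int.gcdA (w 1) (w 2), Int.gcdB (w 0) (Int.gcd (w 1) (w 2)) * Int.gcdB (w 1) (w 2)], ?_⟩, hg0, ?_⟩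
  · simp only [Matrix.cons_val]
    apply mul_left_cancel₀ hg0
    generalize Int.gcdA (w 0) (Int.gcd (w 1) (w 2)) = A at *
    generalize Int.gcdB (w 0) (Int.gcd (w 1) (w 2)) = B at *
    rw [e2] at e1
    generalize Int.gcdA (w 1) (w 2) = A' at *
    generalize Int.gcdB (w 1) (w 2) = B' at *
    clear_value g
    rw [hx, hy, hz] at e1
    linear_combination -e1
  · intro i; fin_cases i <;> assumption

lemma prim_par (v w : Fin 3 → ℤ) (hv : Prim v) (hw : Prim w)
    (h1 : v 1 * w 2 - v 2 * w 1 = 0) (h2 : v 2 * w 0 - v 0 * w 2 = 0)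
    (h3 : v 0 * w 1 - v 1 * w 0 = 0) : v = w ∨ v = - w := by
  obtain ⟨c, hc⟩ := hv
  obtain ⟨d, hd⟩ := hw
  set k := c 0 * w 0 + c 1 * w 1 + c 2 * w 2
  set l := d 0 * v 0 + d 1 * v 1 + d 2 * v 2
  have e0 : w 0 = k * v 0 := by simp only [k]; linear_combination -(w 0) * hc + c 2 * h2 - c 1 * h3
  have e1 : w 1 = k * v 1 := by simp only [k]; linear_combination -(w 1) * hc + c 0 * h3 - c 2 * h1
  have e2 : w 2 = k * v 2 := by simp only [k]; linear_combination -(w 2) * hc + c 1 * h1 - c 0 * h2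
  have hk : k * l = 1 := by
    rw [e0, e1, e2] at hd; simp only [l]; linarith
  rcases Int.eq_one_or_neg_one_of_mul_eq_one hk with h | h
  · left; ext i; fin_cases i <;> simp_all
  · right; ext i; fin_cases i <;> simp_all

lemma int_zero (n : ℤ) (h : |(n : ℝ)| < 1) : n = 0 := by
  rw [← Int.cast_abs] at h
  exact Int.abs_lt_one_iff.1 (by exact_mod_cast h)

lemma par (a b δ ρ T s : ℝ) (v w : Fin 3 → ℤ) (hδ : 0 < δ) (hδρ : δ ≤ ρ / 2) (hρ' : ρ ≤ 1/10)
    (hT : 1 ≤ T) (hw : Sh a b δ T w s)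
    (hv0 : |Lf a b v s| ≤ 3 * ρ / T ^ 2) (hv2 : |(v 2 : ℝ)| < δ * T)
    (hqv : |(v 1 : ℝ) + a * v 2| < 1) (hqw : |(w 1 : ℝ) + a * w 2| < 1) (hP : ¬ Pl δ ρ T s) :
    v 1 * w 2 - v 2 * w 1 = 0 ∧ v 2 * w 0 - v 0 * w 2 = 0 ∧ v 0 * w 1 - v 1 * w 0 = 0 := by
  obtain ⟨hw0, hw1, hw2⟩ := hw
  have bd : ∀ x y X Y x' y' X' Y' : ℝ, |x| ≤ X → |y| < Y → |x'| ≤ X' → |y'| < Y' → 0 < X → 0 < X' → 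
      |x * y - x' * y'| < X * Y + X' * Y' := by
    intro x y X Y x' y' X' Y' h1 h2 h3 h4 h5 h6
    calc |x * y - x' * y'| ≤ |x * y| + |x' * y'| := abs_sub _ _
      _ = |x| * |y| + |x'| * |y'| := by rw [abs_mul, abs_mul]
      _ < _ := by
        have := mul_le_mul_of_nonneg_right h1 (abs_nonneg y)
        have := mul_le_mul_of_nonneg_right h3 (abs_nonneg y')
        have := mul_lt_mul_of_pos_left h2 h5
        have := mul_lt_mul_of_pos_left h4 h6
        linarith
  have hδT : 0 < δ * T := by positivity
  have hρ : 0 < ρ := by linarith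
  have b1 : |((v 1 * w 2 - v 2 * w 1 : ℤ) : ℝ)| < 2 * δ * T := by
    have := bd _ _ _ _ _ _ _ _ hqv.le hw2 hqw.le hv2 one_pos one_pos
    push_cast
    convert this using 1
    · congr 1; ring
    · ring
  have b2 : |((v 2 * w 0 - v 0 * w 2 : ℤ) : ℝ) - s * ((v 1 * w 2 - v 2 * w 1 : ℤ) : ℝ)| < 4 * ρ * δ / T := by
    have := bd _ _ _ _ _ _ _ _ hv2.le hw0 hv0 hw2 hδT (by positivity)
    push_cast
    have e : δ * T * (δ / T ^ 2) + 3 * ρ / T ^ 2 * (δ * T) = (δ + 3 * ρ) * δ / T := by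
      field_simp
    rw [e] at this
    have e2 : (δ + 3 * ρ) * δ / T ≤ 4 * ρ * δ / T := by gcongr; linarith
    refine lt_of_le_of_lt (le_of_eq ?_) (this.trans_le e2)
    congr 1; simp only [Lf]; ring
  have z1 : v 1 * w 2 - v 2 * w 1 = 0 := by
    by_contra hne
    refine hP ⟨-(v 1 * w 2 - v 2 * w 1), v 2 * w 0 - v 0 * w 2, neg_ne_zero.2 hne, ?_, ?_⟩
    · rw [Int.cast_neg, abs_neg]; exact b1
    · refine lt_of_le_of_lt (le_of_eq ?_) b2
      congr 1; rw [Int.cast_neg]; ring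
  have z2 : v 2 * w 0 - v 0 * w 2 = 0 := by
    apply int_zero
    rw [z1] at b2
    simp only [Int.cast_zero, mul_zero, sub_zero] at b2
    refine b2.trans_le ?_
    rw [div_le_one (by linarith)]; nlinarith
  refine ⟨z1, z2, int_zero _ ?_⟩
  have := bd _ _ _ _ _ _ _ _ hv0 hqw hqv.le hw0 (by positivity) one_pos
  have e3 : 3 * ρ / T ^ 2 * 1 + 1 * (δ / T ^ 2) ≤ 1 := by
    have : 3 * ρ / T ^ 2 * 1 + 1 * (δ / T ^ 2) = (3 * ρ + δ) / T ^ 2 := by ring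
    rw [this, div_le_one (by positivity)]; nlinarith
  refine lt_of_le_of_lt (le_of_eq ?_) (this.trans_le e3)
  congr 1
  have z1' : (v 1 * w 2 - v 2 * w 1 : ℝ) = 0 := by exact_mod_cast z1
  have z2' : (v 2 * w 0 - v 0 * w 2 : ℝ) = 0 := by exact_mod_cast z2
  push_cast
  simp only [Lf]
  linear_combination b * z1' + a * z2'

lemma smallSlope (a b δ ρ T s₁ s₂ : ℝ) (h : s₁ < s₂) (hδ : 0 < δ) (hδρ : δ ≤ ρ / 2)
    (hρ' : ρ ≤ 1/10) (hT : 1 ≤ T)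
    (H : ∀ v : Fin 3 → ℤ, v ≠ 0 → |(v 1 : ℝ)| < δ * T → |(v 2 : ℝ)| < δ * T →
      ∃ s ∈ Set.Icc s₁ s₂, ρ / T ^ 2 ≤ |Lf a b v s|) :
    volume {s | s ∈ Set.Icc s₁ s₂ ∧ ¬ Pl δ ρ T s ∧
        ∃ v : Fin 3 → ℤ, Prim v ∧ Sh a b δ T v s ∧ |(v 1 : ℝ) + a * v 2| < 1} ≤
      ENNReal.ofReal (δ / ρ * (9 * (s₂ - s₁))) := by
  have hρ : 0 < ρ := by linarith
  have hT0 : 0 < T := by linarith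
  set q : (Fin 3 → ℤ) → ℝ := fun v => (v 1 : ℝ) + a * v 2 with hq
  set z : (Fin 3 → ℤ) → ℝ := fun v => -(v 0 + b * v 2) / q v with hz
  set r : (Fin 3 → ℤ) → ℝ := fun v => ρ / T ^ 2 / q v with hr
  have key : ∀ v s, 0 < q v → |Lf a b v s| = q v * |s - z v| := by
    intro v s hv
    have hv' := hv.ne'
    rw [← abs_of_pos hv, ← abs_mul]; congr 1
    simp only [hz]; rw [mul_sub, mul_div_cancel₀ _ hv']; simp only [Lf, hq]; ring
  have key2 : ∀ v s κ, 0 < q v → (|Lf a b v s| ≤ κ * (ρ / T ^ 2) ↔ |s - z v| ≤ κ * r v) := by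
    intro v s κ hv
    rw [key v s hv]
    simp only [hr]
    rw [mul_comm, ← le_div_iff₀ hv, mul_div_assoc]
  have hδ' : δ / ρ * (ρ / T ^ 2) = δ / T ^ 2 := by field_simp
  have hle : δ / ρ ≤ 1 / 2 := by rw [div_le_iff₀ hρ]; linarith
  let ι := {v : Fin 3 → ℤ // Prim v ∧ 0 < q v ∧ q v < 1 ∧ ∃ s ∈ Set.Icc s₁ s₂, ¬ Pl δ ρ T s ∧ Sh a b δ T v s}
  have disj : ∀ v w : ι, r w.1 ≤ r v.1 → ¬ Disjoint (Metric.ball (z v.1) (r v.1)) (Metric.ball (z w.1) (r w.1)) → v = w := by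
    rintro ⟨v, hvp, hv0, hv1, sv, hsv, hPv, hvs⟩ ⟨w, hwp, hw0, hw1, sw, hsw, hPw, hws⟩ hrr hnd
    obtain ⟨x, hx1, hx2⟩ := Set.not_disjoint_iff.1 hnd
    simp only [Metric.mem_ball, Real.dist_eq] at hx1 hx2 hrr
    have hrw : 0 < r w := by simp only [hr]; positivity
    have h1 : |sw - z w| ≤ δ / ρ * r w := by
      rw [← key2 w sw _ hw0, hδ']; exact hws.1.le
    have h2 : |sw - z v| ≤ 3 * r v := by
      have : δ / ρ * r w ≤ 1/2 * r w := by gcongr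
      rw [abs_le] at h1 ⊢
      rw [abs_lt] at hx1 hx2
      constructor <;> linarith
    rw [← key2 v sw _ hv0] at h2
    have h3 := par a b δ ρ T sw v w hδ hδρ hρ' hT hws (by rw [mul_div_assoc]; exact h2) hvs.2.2
      (by rw [abs_of_pos hv0]; exact hv1) (by rw [abs_of_pos hw0]; exact hw1) hPw
    apply Subtype.ext
    rcases prim_par v w hvp hwp h3.1 h3.2.1 h3.2.2 with h4 | h4
    · exact h4
    · exfalso
      rw [h4] at hv0
      simp only [hq, Pi.neg_apply, Int.cast_neg] at hv0 hw0
      linarith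
  have := pack (ι := ι) (fun v => z v.1) (fun v => r v.1) (δ / ρ) (s₁ - 4 * (s₂ - s₁)) (s₂ + 4 * (s₂ - s₁))
    (by positivity) {s | s ∈ Set.Icc s₁ s₂ ∧ ¬ Pl δ ρ T s ∧
        ∃ v : Fin 3 → ℤ, Prim v ∧ Sh a b δ T v s ∧ |(v 1 : ℝ) + a * v 2| < 1} ?_ ?_ ?_
  · convert this using 2; ring
  · rintro s ⟨hs, hP, v, hv, hvs, hq1⟩
    have hvne : v ≠ 0 := by
      rintro rfl; obtain ⟨c, hc⟩ := hv; simp at hc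
    have hq0 : q v ≠ 0 := by
      intro h0
      obtain ⟨s', _, hs'⟩ := H v hvne hvs.2.1 hvs.2.2
      have e : Lf a b v s' = Lf a b v s := by
        simp only [hq] at h0
        simp only [Lf]; linear_combination (s' - s) * h0
      rw [e] at hs'
      have := hvs.1
      have : δ / T ^ 2 ≤ ρ / T ^ 2 := by gcongr; linarith
      linarith
    have fin : ∀ v : Fin 3 → ℤ, Prim v → Sh a b δ T v s → |q v| < 1 → 0 < q v → 
        s ∈ ⋃ i : ι, Metric.closedBall (z i.1) (δ / ρ * r i.1) := by
      intro v hv hvs hq1 hq0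
      refine Set.mem_iUnion.2 ⟨⟨v, hv, hq0, (abs_lt.1 hq1).2, s, hs, hP, hvs⟩, ?_⟩
      rw [Metric.mem_closedBall, Real.dist_eq, ← key2 v s _ hq0, hδ']
      exact hvs.1.le
    rcases lt_or_gt_of_ne hq0 with hneg | hpos
    · have hqn : q (-v) = - q v := by simp only [hq, Pi.neg_apply, Int.cast_neg]; ring
      refine fin (-v) ?_ ?_ ?_ ?_
      · obtain ⟨c, hc⟩ := hv
        exact ⟨-c, by simpa using hc⟩
      · obtain ⟨x1, x2, x3⟩ := hvs
        refine ⟨?_, by simpa using x2, by simpa using x3⟩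
        rw [← abs_neg]; convert x1 using 2; simp [Lf]; ring
      · rw [hqn, abs_neg]; exact hq1
      · rw [hqn]; linarith
    · exact fin v hv hvs hq1 hpos
  · intro v w hvw
    by_contra hnd
    rcases le_total (r w.1) (r v.1) with h1 | h1
    · exact hvw (disj v w h1 hnd)
    · exact hvw (disj w v h1 (fun h => hnd h.symm)).symm
  · rintro ⟨v, hvp, hv0, hv1, s, hs, hP, hvs⟩ x hx
    simp only [Metric.mem_ball, Real.dist_eq] at hx
    have hvne : v ≠ 0 := by
      rintro rfl; obtain ⟨c, hc⟩ := hvp; simp at hc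
    obtain ⟨s', hs', hss'⟩ := H v hvne hvs.2.1 hvs.2.2
    have hrv : 0 < r v := by simp only [hr]; positivity
    have h1 : |s - z v| ≤ δ / ρ * r v := by
      rw [← key2 v s _ hv0, hδ']; exact hvs.1.le
    have h1' : δ / ρ * r v ≤ 1/2 * r v := by gcongr
    have h2 : r v ≤ |s' - z v| := by
      rw [key v s' hv0] at hss'
      simp only [hr]
      rw [div_le_iff₀ hv0]; linarith
    have h3 : |s' - z v| ≤ |s' - s| + |s - z v| := abs_sub_le _ _ _
    have h4 : |s' - s| ≤ s₂ - s₁ := by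
      rw [abs_le]; constructor <;> linarith [hs.1, hs.2, hs'.1, hs'.2]
    have h5 : r v ≤ 2 * (s₂ - s₁) := by linarith
    rw [abs_le] at h1
    rw [abs_lt] at hx
    constructor <;> linarith [hs.1, hs.2]

lemma nondiv (a b s₁ s₂ ρ ε : ℝ) (h : s₁ < s₂) (hρ : 0 < ρ) (hρ' : ρ ≤ 1/10) (hε : 0 < ε) :
    ∃ δ, 0 < δ ∧ δ ≤ ρ / 2 ∧ ∃ T₀, 1 ≤ T₀ ∧ ∀ T, T₀ ≤ T →
    (∀ v : Fin 3 → ℤ, v ≠ 0 → |(v 1 : ℝ)| < δ * T → |(v 2 : ℝ)| < δ * T →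
      ∃ s ∈ Set.Icc s₁ s₂, ρ / T ^ 2 ≤ |Lf a b v s|) → 
    volume {s | s ∈ Set.Icc s₁ s₂ ∧ ∃ v : Fin 3 → ℤ, v ≠ 0 ∧ Sh a b δ T v s} ≤ ENNReal.ofReal ε := by
  have hlim : Tendsto (fun δ : ℝ => 18 * δ ^ 3 * ((s₂ - s₁) + 2) + 48 * ρ * δ ^ 2 * ((s₂ - s₁) + 2) + δ / ρ * (9 * (s₂ - s₁)))
      (𝓝[>] 0) (𝓝 0) := by
    apply tendsto_nhdsWithin_of_tendsto_nhds
    have : Continuous (fun δ : ℝ => 18 * δ ^ 3 * ((s₂ - s₁) + 2) + 48 * ρ * δ ^ 2 * ((s₂ - s₁) + 2) + δ / ρ * (9 * (s₂ - s₁))) := by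
      fun_prop
    convert this.tendsto 0 using 2
    simp
  have e0 : ∀ᶠ δ : ℝ in 𝓝[>] 0, 0 < δ := self_mem_nhdsWithin
  have e1 : ∀ᶠ δ : ℝ in 𝓝[>] 0, δ ≤ ρ / 2 :=
    mem_nhdsWithin_of_mem_nhds (Iic_mem_nhds (by positivity))
  obtain ⟨δ, hδε, hδ, hδρ⟩ := ((hlim.eventually (gt_mem_nhds hε)).and (e0.and e1)).exists
  refine ⟨δ, hδ, hδρ, max 1 (1/δ), le_max_left _ _, ?_⟩
  intro T hT H
  have hT1 : 1 ≤ T := (le_max_left _ _).trans hT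
  have hδT : 1 ≤ δ * T := by
    have := (le_max_right _ _).trans hT
    rw [div_le_iff₀ hδ] at this; linarith
  have hsub : {s | s ∈ Set.Icc s₁ s₂ ∧ ∃ v : Fin 3 → ℤ, v ≠ 0 ∧ Sh a b δ T v s} ⊆
    ({s | s ∈ Set.Icc s₁ s₂ ∧ ∃ v : Fin 3 → ℤ, Sh a b δ T v s ∧ 1 ≤ |(v 1 : ℝ) + a * v 2|} ∪
      {s | s ∈ Set.Icc s₁ s₂ ∧ Pl δ ρ T s}) ∪ {s | s ∈ Set.Icc s₁ s₂ ∧ ¬ Pl δ ρ T s ∧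
        ∃ v : Fin 3 → ℤ, Prim v ∧ Sh a b δ T v s ∧ |(v 1 : ℝ) + a * v 2| < 1} := by
    rintro s ⟨hs, w, hw, h1, h2, h3⟩
    obtain ⟨v, d, hv, hd, hwv⟩ := exists_prim w hw
    have hd1 : (1:ℝ) ≤ |(d:ℝ)| := by
      rw [← Int.cast_abs]; exact_mod_cast Int.one_le_abs hd
    have ge : ∀ x : ℝ, |x| ≤ |d * x| := fun x => by
      rw [abs_mul]; nlinarith [abs_nonneg x]
    have hvs : Sh a b δ T v s := by
      refine ⟨lt_of_le_of_lt ?_ h1, lt_of_le_of_lt ?_ h2, lt_of_le_of_lt ?_ h3⟩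
      · have : Lf a b w s = d * Lf a b v s := by
          simp only [Lf, hwv]; push_cast; ring
        rw [this]; exact ge _
      · rw [hwv]; push_cast; exact ge _
      · rw [hwv]; push_cast; exact ge _
    by_cases hP : Pl δ ρ T s
    · exact Or.inl (Or.inr ⟨hs, hP⟩)
    by_cases hq : 1 ≤ |(v 1 : ℝ) + a * v 2|
    · exact Or.inl (Or.inl ⟨hs, v, hvs, hq⟩)
    · exact Or.inr ⟨hs, hP, v, hv, hvs, not_le.1 hq⟩
  have hl : 0 < s₂ - s₁ := by linarith
  refine (measure_mono hsub).trans ((measure_union_le _ _).trans ?_)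
  refine (add_le_add (measure_union_le _ _) le_rfl).trans ?_
  refine (add_le_add (add_le_add (largeSlope a b δ T s₁ s₂ h hδ (by linarith) hT1 hδT)
    (planes δ ρ T s₁ s₂ h hδ (by linarith) hρ hρ' hT1 hδT))
    (smallSlope a b δ ρ T s₁ s₂ h hδ hδρ hρ' hT1 H)).trans ?_
  rw [← ENNReal.ofReal_add (by positivity) (by positivity), ← ENNReal.ofReal_add (by positivity) (by positivity)]
  exact ENNReal.ofReal_le_ofReal hδε.le

instance : IsTopologicalGroup G := Matrix.SpecialLinearGroup.topologicalGroup
instance : BorelSpace X := ⟨rfl⟩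

lemma coe_continuous : Continuous (fun g : G => (g : Matrix (Fin 3) (Fin 3) ℝ)) :=
  continuous_induced_dom

lemma scalar_red (A B C f g h d : ℝ) (hd : 0 < d) (hA : d ≤ A) (hB : d ≤ B) (hAC : A ≤ C)
    (hBC : B ≤ C) (hfA : 2 * |f| ≤ A) (hfB : 2 * |f| ≤ B)
    (hdet : A * B * C + 2 * f * g * h - A * h ^ 2 - B * g ^ 2 - C * f ^ 2 = 1)
    (hmin : ∀ m n : ℤ, 0 ≤ (m:ℝ) ^ 2 * A + n ^ 2 * B + 2 * m * g + 2 * n * h + 2 * m * n * f) :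
    C ≤ 16 / (3 * d ^ 2) := by
  have hA0 : 0 < A := by linarith
  have hB0 : 0 < B := by linarith
  have hff : f ^ 2 ≤ A * B / 4 := by
    rw [← sq_abs]; nlinarith [abs_nonneg f]
  have hAB : d ^ 2 ≤ A * B := by nlinarith
  have hD : 3 / 4 * d ^ 2 ≤ A * B - f ^ 2 := by linarith
  have hD0 : 0 < A * B - f ^ 2 := lt_of_lt_of_le (by positivity) hD
  set D := A * B - f ^ 2 with hDdef
  obtain ⟨α, hα⟩ : ∃ α, α * D = g * B - h * f := ⟨(g * B - h * f) / D, by field_simp⟩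
  obtain ⟨β, hβ⟩ : ∃ β, β * D = h * A - g * f := ⟨(h * A - g * f) / D, by field_simp⟩
  have e1 : α * A + β * f = g := by
    apply mul_right_cancel₀ hD0.ne'
    simp only [hDdef] at *
    linear_combination A * hα + f * hβ
  have e2 : α * f + β * B = h := by
    apply mul_right_cancel₀ hD0.ne'
    simp only [hDdef] at *
    linear_combination f * hα + B * hβ
  have e3 : D * (C - (α ^ 2 * A + β ^ 2 * B + 2 * α * β * f)) = 1 := by
    rw [← hdet, ← e1, ← e2, hDdef]; ring
  have hm := hmin (-round α) (-round β)
  have r1 := abs_sub_round α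
  have r2 := abs_sub_round β
  push_cast at hm
  set m : ℝ := (round α : ℝ)
  set n : ℝ := (round β : ℝ)
  have q1 : α ^ 2 * A + β ^ 2 * B + 2 * α * β * f ≤
      (α - m) ^ 2 * A + (β - n) ^ 2 * B + 2 * ((α - m) * (β - n)) * f := by
    rw [← e1, ← e2] at hm; nlinarith
  have q2 : (α - m) ^ 2 ≤ 1 / 4 := by rw [← sq_abs]; nlinarith [abs_nonneg (α - m)]
  have q3 : (β - n) ^ 2 ≤ 1 / 4 := by rw [← sq_abs]; nlinarith [abs_nonneg (β - n)]
  have q4 : ((α - m) * (β - n)) * f ≤ 1 / 4 * |f| := by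
    refine (le_abs_self _).trans ?_
    rw [abs_mul, abs_mul]
    have y1 : |α - m| * |β - n| ≤ 1 / 2 * (1 / 2) :=
      mul_le_mul r1 r2 (abs_nonneg _) (by norm_num)
    have y2 := mul_le_mul_of_nonneg_right y1 (abs_nonneg f)
    linarith
  have q5 : α ^ 2 * A + β ^ 2 * B + 2 * α * β * f ≤ 3 / 4 * C := by
    have x1 := mul_le_mul_of_nonneg_right q2 hA0.le
    have x2 := mul_le_mul_of_nonneg_right q3 hB0.le
    linarith
  have q6 : D * (C / 4) ≤ 1 := by
    rw [← e3]
    exact mul_le_mul_of_nonneg_left (by linarith) hD0.le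
  have hC : 0 < C := by linarith
  rw [le_div_iff₀ (by positivity)]
  have q7 := mul_le_mul_of_nonneg_right hD (show 0 ≤ C / 4 by linarith)
  linarith

def Fm (P : Matrix (Fin 3) (Fin 3) ℝ) : ℝ := ∑ i, ∑ j, P i j ^ 2

def dt (P : Matrix (Fin 3) (Fin 3) ℝ) (i j : Fin 3) : ℝ := P 0 i * P 0 j + P 1 i * P 1 j + P 2 i * P 2 j

lemma reduced_bd (P : Matrix (Fin 3) (Fin 3) ℝ) (d : ℝ) (hd : 0 < d) (hdet : P.det = 1)
    (hP : ∀ i, d ≤ dt P i i)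
    (hmin : ∀ E : Matrix (Fin 3) (Fin 3) ℤ, E.det = 1 → Fm P ≤ Fm (P * E.map (Int.cast : ℤ → ℝ))) :
    ∀ i, dt P i i ≤ 16 / (3 * d ^ 2) := by
  have h2 : ∀ m n : ℤ, 0 ≤ (m:ℝ) ^ 2 * dt P 0 0 + n ^ 2 * dt P 1 1 + 2 * m * dt P 0 2 + 2 * n * dt P 1 2 + 2 * m * n * dt P 0 1 := by
    intro m n
    have := hmin !![1, 0, m; 0, 1, n; 0, 0, 1] (by simp [Matrix.det_fin_three])
    simp [Fm, Matrix.mul_apply, Fin.sum_univ_three] at this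
    simp only [dt]; nlinarith
  have h1 : ∀ m n : ℤ, 0 ≤ (m:ℝ) ^ 2 * dt P 0 0 + n ^ 2 * dt P 2 2 + 2 * m * dt P 0 1 + 2 * n * dt P 1 2 + 2 * m * n * dt P 0 2 := by
    intro m n
    have := hmin !![1, m, 0; 0, 1, 0; 0, n, 1] (by simp [Matrix.det_fin_three])
    simp [Fm, Matrix.mul_apply, Fin.sum_univ_three] at this
    simp only [dt]; nlinarith
  have h0 : ∀ m n : ℤ, 0 ≤ (m:ℝ) ^ 2 * dt P 1 1 + n ^ 2 * dt P 2 2 + 2 * m * dt P 0 1 + 2 * n * dt P 0 2 + 2 * m * n * dt P 1 2 := by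
    intro m n
    have := hmin !![1, 0, 0; m, 1, 0; n, 0, 1] (by simp [Matrix.det_fin_three])
    simp [Fm, Matrix.mul_apply, Fin.sum_univ_three] at this
    simp only [dt]; nlinarith
  have ab : ∀ A f : ℝ, 0 ≤ A + 2 * f → 0 ≤ A - 2 * f → 2 * |f| ≤ A := by
    intro A f h h'
    rcases abs_cases f with ⟨e, _⟩ | ⟨e, _⟩ <;> rw [e] <;> linarith
  have i01 : 2 * |dt P 0 1| ≤ dt P 0 0 := by
    have x := h1 1 0
    have y := h1 (-1) 0
    norm_num at x y
    exact ab _ _ (by linarith) (by linarith)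
  have i02 : 2 * |dt P 0 2| ≤ dt P 0 0 := by
    have x := h2 1 0
    have y := h2 (-1) 0
    norm_num at x y
    exact ab _ _ (by linarith) (by linarith)
  have i10 : 2 * |dt P 0 1| ≤ dt P 1 1 := by
    have x := h0 1 0
    have y := h0 (-1) 0
    norm_num at x y
    exact ab _ _ (by linarith) (by linarith)
  have i12 : 2 * |dt P 1 2| ≤ dt P 1 1 := by
    have x := h2 0 1
    have y := h2 0 (-1)
    norm_num at x y
    exact ab _ _ (by linarith) (by linarith)
  have i20 : 2 * |dt P 0 2| ≤ dt P 2 2 := by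
    have x := h0 0 1
    have y := h0 0 (-1)
    norm_num at x y
    exact ab _ _ (by linarith) (by linarith)
  have i21 : 2 * |dt P 1 2| ≤ dt P 2 2 := by
    have x := h1 0 1
    have y := h1 0 (-1)
    norm_num at x y
    exact ab _ _ (by linarith) (by linarith)
  have hg : dt P 0 0 * dt P 1 1 * dt P 2 2 + 2 * dt P 0 1 * dt P 0 2 * dt P 1 2 - dt P 0 0 * dt P 1 2 ^ 2
      - dt P 1 1 * dt P 0 2 ^ 2 - dt P 2 2 * dt P 0 1 ^ 2 = 1 := by
    have : P.det ^ 2 = 1 := by rw [hdet]; norm_num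
    rw [← this, Matrix.det_fin_three]
    simp only [dt]; ring
  have a0 := hP 0
  have a1 := hP 1
  have a2 := hP 2
  generalize dt P 0 1 = f at *
  generalize dt P 0 2 = g at *
  generalize dt P 1 2 = h at *
  have main : dt P 0 0 ≤ 16 / (3 * d ^ 2) ∧ dt P 1 1 ≤ 16 / (3 * d ^ 2) ∧ dt P 2 2 ≤ 16 / (3 * d ^ 2) := by
    generalize dt P 0 0 = A at *
    generalize dt P 1 1 = B at *
    generalize dt P 2 2 = C at *
    rcases le_total A B with hAB | hAB <;> rcases le_total B C with hBC | hBC <;>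
      rcases le_total A C with hAC | hAC
    all_goals first
      | (have := scalar_red A B C f g h d hd a0 a1 (by linarith) (by linarith) i01 i10 hg h2
         refine ⟨?_, ?_, ?_⟩ <;> linarith)
      | (have := scalar_red A C B g f h d hd a0 a2 (by linarith) (by linarith) i02 i20 (by linarith) h1
         refine ⟨?_, ?_, ?_⟩ <;> linarith)
      | (have := scalar_red B C A h f g d hd a1 a2 (by linarith) (by linarith) i12 i21 (by linarith) h0
         refine ⟨?_, ?_, ?_⟩ <;> linarith)
  intro i; fin_cases i
  · exact main.1
  · exact main.2.1
  · exact main.2.2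

lemma Fm_entry (P : Matrix (Fin 3) (Fin 3) ℝ) (i j : Fin 3) : P i j ^ 2 ≤ Fm P := by
  refine (Finset.single_le_sum (f := fun j => P i j ^ 2) (fun j _ => sq_nonneg _) (Finset.mem_univ j)).trans ?_
  exact Finset.single_le_sum (f := fun i => ∑ j, P i j ^ 2)
    (fun i _ => Finset.sum_nonneg fun j _ => sq_nonneg _) (Finset.mem_univ i)

abbrev toG (γ : Matrix.SpecialLinearGroup (Fin 3) ℤ) : G :=
  Matrix.SpecialLinearGroup.map (n := Fin 3) (Int.castRingHom ℝ) γ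

lemma toG_apply (γ : Matrix.SpecialLinearGroup (Fin 3) ℤ) (i j) :
    (toG γ : Matrix (Fin 3) (Fin 3) ℝ) i j = ((γ : Matrix (Fin 3) (Fin 3) ℤ) i j : ℝ) := rfl

lemma exists_min (g : G) : ∃ γ : Matrix.SpecialLinearGroup (Fin 3) ℤ, ∀ γ',
    Fm (g * toG γ : G) ≤ Fm (g * toG γ' : G) := by
  set F : Matrix.SpecialLinearGroup (Fin 3) ℤ → ℝ := fun γ => Fm (g * toG γ : G) with hF
  have hfin : {γ | F γ ≤ F 1}.Finite := by
    set R := F 1 + 1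
    have hR : 0 ≤ R := by
      have : 0 ≤ F 1 := Finset.sum_nonneg fun i _ => Finset.sum_nonneg fun j _ => sq_nonneg _
      linarith
    obtain ⟨N, hN⟩ := exists_nat_ge (3 * (1 + Fm (g⁻¹ : G)) * R)
    have hS : (Set.pi Set.univ (fun _ : Fin 3 => Set.pi Set.univ fun _ : Fin 3 => Set.Icc (-(N:ℤ)) N)).Finite :=
      Set.Finite.pi fun _ => Set.Finite.pi fun _ => Set.finite_Icc _ _
    refine Set.Finite.of_finite_image (f := fun γ : Matrix.SpecialLinearGroup (Fin 3) ℤ => (fun i j => (γ : Matrix (Fin 3) (Fin 3) ℤ) i j : Fin 3 → Fin 3 → ℤ)) (hS.subset ?_) ?_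
    · rintro _ ⟨γ, hγ, rfl⟩ i _ j _
      simp only [Set.mem_ofPred_eq] at hγ
      have e : (toG γ : Matrix (Fin 3) (Fin 3) ℝ) i j = ∑ k, ((g⁻¹ : G) : Matrix (Fin 3) (Fin 3) ℝ) i k * ((g * toG γ : G) : Matrix (Fin 3) (Fin 3) ℝ) k j := by
        rw [← Matrix.mul_apply, ← Matrix.SpecialLinearGroup.coe_mul, inv_mul_cancel_left]
      have b1 : ∀ k, |((g⁻¹ : G) : Matrix (Fin 3) (Fin 3) ℝ) i k| ≤ 1 + Fm (g⁻¹ : G) := by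
        intro k
        have := Fm_entry (g⁻¹ : G) i k
        rw [← sq_abs] at this
        nlinarith [sq_nonneg (|((g⁻¹ : G) : Matrix (Fin 3) (Fin 3) ℝ) i k| - 1)]
      have b2 : ∀ k, |((g * toG γ : G) : Matrix (Fin 3) (Fin 3) ℝ) k j| ≤ R := by
        intro k
        have := Fm_entry (g * toG γ : G) k j
        rw [← sq_abs] at this
        have h3 : Fm (g * toG γ : G) ≤ F 1 := hγ
        simp only [R]
        nlinarith [sq_nonneg (|((g * toG γ : G) : Matrix (Fin 3) (Fin 3) ℝ) k j| - 1)]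
      have b3 : |((γ : Matrix (Fin 3) (Fin 3) ℤ) i j : ℝ)| ≤ N := by
        rw [← toG_apply, e]
        refine (Finset.abs_sum_le_sum_abs _ _).trans (le_trans ?_ hN)
        calc _ ≤ ∑ k : Fin 3, (1 + Fm (g⁻¹ : G)) * R := by
              apply Finset.sum_le_sum
              intro k _
              rw [abs_mul]
              exact mul_le_mul (b1 k) (b2 k) (abs_nonneg _) ((abs_nonneg _).trans (b1 k))
          _ = _ := by simp; ring
      rw [abs_le] at b3
      constructor
      · exact_mod_cast b3.1
      · exact_mod_cast b3.2
    · intro γ _ γ' _ hh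
      apply Subtype.ext
      ext i j
      exact congrFun (congrFun hh i) j
  obtain ⟨γ, hγ, hm⟩ := Set.exists_min_image _ F hfin ⟨1, show F 1 ≤ F 1 from le_rfl⟩
  refine ⟨γ, fun γ' => ?_⟩
  by_cases h : F γ' ≤ F 1
  · exact hm γ' h
  · exact le_trans hγ (not_le.1 h).le

lemma compact_box (M : ℝ) : IsCompact {g : G | ∀ i j, |(g : Matrix (Fin 3) (Fin 3) ℝ) i j| ≤ M} := by
  have hce : IsClosedEmbedding (fun g : G => (g : Matrix (Fin 3) (Fin 3) ℝ)) :=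
    Matrix.SpecialLinearGroup.isClosedEmbedding_val
  have hS : IsCompact (Set.pi Set.univ (fun _ : Fin 3 => Set.pi Set.univ fun _ : Fin 3 => Set.Icc (-M) M)) :=
    isCompact_univ_pi fun _ => isCompact_univ_pi fun _ => isCompact_Icc
  have := hce.isCompact_preimage (K := (Set.pi Set.univ (fun _ : Fin 3 => Set.pi Set.univ fun _ : Fin 3 => Set.Icc (-M) M))) hS
  convert this using 1
  ext g
  constructor
  · intro hg i _ j _
    exact abs_le.1 (hg i j)
  · intro hg i j
    exact abs_le.2 (hg i trivial j trivial)

lemma mulVec_ne (γ : Matrix.SpecialLinearGroup (Fin 3) ℤ) (v : Fin 3 → ℤ) (hv : v ≠ 0) :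
    (γ : Matrix (Fin 3) (Fin 3) ℤ).mulVec v ≠ 0 := by
  intro h
  apply hv
  have : ((γ⁻¹ * γ : Matrix.SpecialLinearGroup (Fin 3) ℤ) : Matrix (Fin 3) (Fin 3) ℤ).mulVec v = 0 := by
    rw [Matrix.SpecialLinearGroup.coe_mul, ← Matrix.mulVec_mulVec, h, Matrix.mulVec_zero]
  simpa using this

lemma toG_mulVec (γ : Matrix.SpecialLinearGroup (Fin 3) ℤ) (v : Fin 3 → ℤ) :
    (toG γ : Matrix (Fin 3) (Fin 3) ℝ).mulVec (fun i => (v i : ℝ)) =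
      fun i => (((γ : Matrix (Fin 3) (Fin 3) ℤ).mulVec v i : ℤ) : ℝ) := by
  ext i
  simp [Matrix.mulVec, dotProduct]

lemma mahler_cpt (δ : ℝ) (hδ : 0 < δ) : ∃ K : Set X, IsCompact K ∧ ∀ g : G,
    (∀ v : Fin 3 → ℤ, v ≠ 0 → δ ≤ ‖(g : Matrix (Fin 3) (Fin 3) ℝ).mulVec (fun i => (v i : ℝ))‖) →
    (g : X) ∈ K := by
  set M := 1 + 16 / (3 * (δ ^ 2) ^ 2)
  refine ⟨(fun g : G => (g : X)) '' {g : G | ∀ i j, |(g : Matrix (Fin 3) (Fin 3) ℝ) i j| ≤ M},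
    (compact_box M).image continuous_quot_mk, ?_⟩
  intro g hg
  obtain ⟨γ, hγ⟩ := exists_min g
  refine ⟨g * toG γ, ?_, ?_⟩
  · set P : Matrix (Fin 3) (Fin 3) ℝ := ((g * toG γ : G) : Matrix (Fin 3) (Fin 3) ℝ) with hPd
    have key := reduced_bd P (δ ^ 2) (by positivity) (g * toG γ : G).2 ?_ ?_
    · intro i j
      have h1 : P i j ^ 2 ≤ dt P j j := by
        simp only [dt]
        fin_cases i <;> simp <;> nlinarith [sq_nonneg (P 0 j), sq_nonneg (P 1 j), sq_nonneg (P 2 j)]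
      have h2 := key j
      rw [← sq_abs] at h1
      show |P i j| ≤ M
      simp only [M]
      nlinarith [sq_nonneg (|P i j| - 1)]
    · intro j
      have h1 := hg ((γ : Matrix (Fin 3) (Fin 3) ℤ).mulVec (Pi.single j 1)) (mulVec_ne γ _ (by simp))
      rw [← toG_mulVec, Matrix.mulVec_mulVec, ← Matrix.SpecialLinearGroup.coe_mul, ← hPd] at h1
      have e : P.mulVec (fun i => ((Pi.single j 1 : Fin 3 → ℤ) i : ℝ)) = fun i => P i j := by
        ext i
        have : (fun i => ((Pi.single j 1 : Fin 3 → ℤ) i : ℝ)) = Pi.single j 1 := by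
          ext k; by_cases h : k = j
          · subst h; simp
          · simp [h]
        rw [this]; simp
      rw [e] at h1
      by_contra hlt
      push Not at hlt
      apply absurd h1
      rw [not_le, pi_norm_lt_iff hδ]
      intro i
      rw [Real.norm_eq_abs]
      apply abs_lt_of_sq_lt_sq _ hδ.le
      refine lt_of_le_of_lt ?_ hlt
      simp only [dt]
      fin_cases i <;> simp <;> nlinarith [sq_nonneg (P 0 j), sq_nonneg (P 1 j), sq_nonneg (P 2 j)]
    · intro E hE
      obtain ⟨E', rfl⟩ : ∃ E' : Matrix.SpecialLinearGroup (Fin 3) ℤ, (E' : Matrix (Fin 3) (Fin 3) ℤ) = E :=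
        ⟨⟨E, hE⟩, rfl⟩
      have := hγ (γ * E')
      have e : toG (γ * E') = toG γ * toG E' := map_mul _ _ _
      rw [e, ← mul_assoc, Matrix.SpecialLinearGroup.coe_mul (g * toG γ)] at this
      exact this
  · exact (QuotientGroup.eq.2 ⟨γ⁻¹, by simp [toG]⟩)

lemma compact_low (K : Set X) (hK : IsCompact K) : ∃ V : Set X, IsOpen V ∧ K ⊆ V ∧ ∃ δ : ℝ, 0 < δ ∧
    ∀ g : G, (g : X) ∈ V → ∀ v : Fin 3 → ℤ, v ≠ 0 →
      δ ≤ ‖(g : Matrix (Fin 3) (Fin 3) ℝ).mulVec (fun i => (v i : ℝ))‖ := by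
  set U : ℕ → Set G := fun M => {g | ∀ i j, |((g⁻¹ : G) : Matrix (Fin 3) (Fin 3) ℝ) i j| < M} with hU
  have hUo : ∀ M, IsOpen (U M) := by
    intro M
    simp only [hU, Set.ofPred_forall]
    refine isOpen_iInter_of_finite fun i => isOpen_iInter_of_finite fun j => ?_
    refine isOpen_lt ?_ continuous_const
    have : Continuous fun g : G => ((g⁻¹ : G) : Matrix (Fin 3) (Fin 3) ℝ) := coe_continuous.comp continuous_inv
    exact (this.matrix_elem i j).abs
  set W : ℕ → Set X := fun M => (fun g : G => (g : X)) '' U M with hW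
  have hWo : ∀ M, IsOpen (W M) := fun M => QuotientGroup.isOpenMap_coe _ (hUo M)
  have hmono : Monotone W := by
    intro M N h
    apply Set.image_mono
    intro g hg i j
    exact (hg i j).trans_le (by exact_mod_cast h)
  have hcov : K ⊆ ⋃ M, W M := by
    intro x _
    obtain ⟨g, rfl⟩ := QuotientGroup.mk_surjective x
    obtain ⟨N, hN⟩ := exists_nat_gt (1 + Fm (g⁻¹ : G))
    refine Set.mem_iUnion.2 ⟨N, g, ?_, rfl⟩
    intro i k
    have := Fm_entry (g⁻¹ : G) i k
    rw [← sq_abs] at this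
    nlinarith [sq_nonneg (|((g⁻¹ : G) : Matrix (Fin 3) (Fin 3) ℝ) i k| - 1)]
  obtain ⟨M, hM⟩ := hK.elim_directed_cover W hWo hcov hmono.directed_le
  refine ⟨W (M + 1), hWo _, hM.trans (hmono (Nat.le_succ _)), 1 / (3 * ((M + 1 : ℕ) : ℝ)), by positivity, ?_⟩
  rintro g ⟨g', hg', hgg'⟩ v hv
  obtain ⟨γ, hγ⟩ := QuotientGroup.eq.1 hgg'
  have hγ' : toG γ = g'⁻¹ * g := hγ
  have hne := mulVec_ne γ v hv
  obtain ⟨i, hi⟩ := Function.ne_iff.1 hne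
  have h1 : (1:ℝ) ≤ |(((γ : Matrix (Fin 3) (Fin 3) ℤ).mulVec v i : ℤ) : ℝ)| := by
    rw [← Int.cast_abs]; exact_mod_cast Int.one_le_abs hi
  have e := congrFun (toG_mulVec γ v) i
  rw [← e, hγ', Matrix.SpecialLinearGroup.coe_mul, ← Matrix.mulVec_mulVec] at h1
  set y := (g : Matrix (Fin 3) (Fin 3) ℝ).mulVec (fun i => (v i : ℝ))
  rw [div_le_iff₀ (by positivity)]
  refine h1.trans ?_
  calc _ ≤ ∑ k, |((g'⁻¹ : G) : Matrix (Fin 3) (Fin 3) ℝ) i k * y k| := Finset.abs_sum_le_sum_abs _ _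
    _ ≤ ∑ k : Fin 3, ((M + 1 : ℕ) : ℝ) * ‖y‖ := by
      apply Finset.sum_le_sum
      intro k _
      rw [abs_mul]
      exact mul_le_mul (hg' i k).le (norm_le_pi_norm y k) (abs_nonneg _) (by positivity)
    _ = _ := by simp; ring

lemma orbit_eq (a b t s : ℝ) : gSL t • phiSL a b s • x₀ = ((gSL t * phiSL a b s : G) : X) := by
  rw [smul_smul]
  show ((gSL t * phiSL a b s * 1 : G) : X) = _
  rw [mul_one]

lemma phi_cont (a b : ℝ) : Continuous (fun s => phiSL a b s) := by
  refine continuous_induced_rng.2 ?_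
  refine continuous_matrix fun i j => ?_
  fin_cases i <;> fin_cases j <;> simp [phiSL] <;> fun_prop

lemma mulVec_eq (a b t s : ℝ) (v : Fin 3 → ℤ) :
    ((gSL t * phiSL a b s : G) : Matrix (Fin 3) (Fin 3) ℝ).mulVec (fun i => (v i : ℝ)) =
      ![Real.exp t ^ 2 * Lf a b v s, (Real.exp t)⁻¹ * v 1, (Real.exp t)⁻¹ * v 2] := by
  have e : Real.exp (2 * t) = Real.exp t ^ 2 := by
    rw [← Real.exp_nat_mul]; norm_num
  rw [Matrix.SpecialLinearGroup.coe_mul, ← Matrix.mulVec_mulVec]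
  ext i
  simp only [gSL, phiSL, Matrix.mulVec_diagonal]
  fin_cases i
  · simp [Matrix.mulVec, dotProduct, Fin.sum_univ_three, Lf, e]
  · simp [Matrix.mulVec, dotProduct, Fin.sum_univ_three, Real.exp_neg]
  · simp [Matrix.mulVec, dotProduct, Fin.sum_univ_three, Real.exp_neg]

lemma norm_lt_iff_Sh (a b t s δ : ℝ) (hδ : 0 < δ) (v : Fin 3 → ℤ) :
    ‖((gSL t * phiSL a b s : G) : Matrix (Fin 3) (Fin 3) ℝ).mulVec (fun i => (v i : ℝ))‖ < δ ↔
      Sh a b δ (Real.exp t) v s := by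
  have hT := Real.exp_pos t
  rw [mulVec_eq, pi_norm_lt_iff hδ, Sh]
  generalize Real.exp t = T at *
  simp only [Fin.forall_fin_succ, Real.norm_eq_abs]
  simp [abs_mul, abs_of_pos hT]
  rw [lt_div_iff₀ (by positivity), inv_mul_lt_iff₀ hT, inv_mul_lt_iff₀ hT, mul_comm T δ, mul_comm (T ^ 2)]

lemma bddAbove_orbit (a b s₁ s₂ t : ℝ) (v : Fin 3 → ℤ) :
    BddAbove (Set.range fun s : Set.Icc s₁ s₂ => 
      ‖((gSL t * phiSL a b (s : ℝ) : G) : Matrix (Fin 3) (Fin 3) ℝ).mulVec (fun i => (v i : ℝ))‖) := by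
  apply IsCompact.bddAbove
  apply isCompact_range
  have : Continuous fun s : Set.Icc s₁ s₂ => ((gSL t * phiSL a b (s : ℝ) : G) : Matrix (Fin 3) (Fin 3) ℝ) :=
    coe_continuous.comp (continuous_const.mul ((phi_cont a b).comp continuous_subtype_val))
  exact (this.matrix_mulVec continuous_const).norm

lemma sup_nonneg (a b s₁ s₂ t : ℝ) (v : Fin 3 → ℤ) : 0 ≤ supNormOrbit a b s₁ s₂ t v :=
  Real.iSup_nonneg fun _ => norm_nonneg _

lemma phix_cont (a b : ℝ) : Continuous (fun s => phiSL a b s • x₀) := by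
  have e : (fun s => phiSL a b s • x₀) = fun s => ((phiSL a b s : G) : X) := by
    funext s
    show ((phiSL a b s * 1 : G) : X) = _
    rw [mul_one]
  rw [e]
  exact continuous_quot_mk.comp (phi_cont a b)

lemma gt_open (a b s₁ s₂ t : ℝ) (V : Set X) (hV : IsOpen V)
    (hn : ∀ s ∈ Set.Icc s₁ s₂, gSL t • phiSL a b s • x₀ ∉ V) : gtLambda a b s₁ s₂ t V = 0 := by
  have hc : Continuous (fun x : X => gSL t • x) := continuous_const_smul _
  rw [gtLambda, Measure.map_apply hc.measurable hV.measurableSet, lambdaAB,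
    Measure.map_apply (phix_cont a b).measurable (hc.measurable hV.measurableSet),
    Measure.smul_apply, Measure.restrict_apply' measurableSet_Icc]
  have : ((fun s => phiSL a b s • x₀) ⁻¹' ((fun x : X => gSL t • x) ⁻¹' V)) ∩ Set.Icc s₁ s₂ = ∅ := by
    ext s
    simp only [Set.mem_inter_iff, Set.mem_preimage, Set.mem_empty_iff_false, iff_false, not_and]
    exact fun h1 h2 => hn s h2 h1
  rw [this]; simp

lemma gt_low (a b s₁ s₂ t : ℝ) (K : Set X) :
    (volume (Set.Icc s₁ s₂))⁻¹ * volume {s | s ∈ Set.Icc s₁ s₂ ∧ gSL t • phiSL a b s • x₀ ∈ K} ≤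
      gtLambda a b s₁ s₂ t K := by
  have hc : Continuous (fun x : X => gSL t • x) := continuous_const_smul _
  refine le_trans ?_ (Measure.le_map_apply hc.measurable.aemeasurable K)
  refine le_trans ?_ (Measure.le_map_apply (phix_cont a b).measurable.aemeasurable _)
  rw [Measure.smul_apply, Measure.restrict_apply' measurableSet_Icc, smul_eq_mul]
  gcongr
  rintro s ⟨h1, h2⟩
  exact ⟨h2, h1⟩

lemma imp_2_3 (a b s₁ s₂ : ℝ) (h : s₁ < s₂) (t : ℕ → ℝ) (ht : Tendsto t atTop atTop)
    (ε : ℝ) (hε : 0 < ε) (H : ∀ K : Set X, IsCompact K →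
          ∀ᶠ i in atTop, gtLambda a b s₁ s₂ (t i) K ≤ ENNReal.ofReal (1 - ε)) (δ₀ : ℝ) (hδ₀ : 0 < δ₀) :
    ∀ᶠ i in atTop, ∃ v : Fin 3 → ℤ, v ≠ 0 ∧ supNormOrbit a b s₁ s₂ (t i) v < δ₀ := by
  set ρ := min (δ₀ / 2) (1 / 10) with hρd
  have hρ : 0 < ρ := by positivity
  have hl : 0 < s₂ - s₁ := by linarith
  set ε' := min ε 1 with hε'
  have hε'0 : 0 < ε' := by positivity
  obtain ⟨δ, hδ, hδρ, T₀, hT₀, hnd⟩ := nondiv a b s₁ s₂ ρ (ε' / 2 * (s₂ - s₁)) h hρ (min_le_right _ _) (by positivity)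
  obtain ⟨K, hK, hKg⟩ := mahler_cpt δ hδ
  have hTe : ∀ᶠ i in atTop, T₀ ≤ Real.exp (t i) :=
    (Real.tendsto_exp_atTop.comp ht).eventually_ge_atTop T₀
  filter_upwards [H K hK, hTe] with i hi hTi
  by_contra hno
  push Not at hno
  have hT := Real.exp_pos (t i)
  have hvol := hnd (Real.exp (t i)) hTi ?_
  · have hcov : Set.Icc s₁ s₂ ⊆ {s | s ∈ Set.Icc s₁ s₂ ∧ gSL (t i) • phiSL a b s • x₀ ∈ K} ∪
        {s | s ∈ Set.Icc s₁ s₂ ∧ ∃ v : Fin 3 → ℤ, v ≠ 0 ∧ Sh a b δ (Real.exp (t i)) v s} := by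
      intro s hs
      by_cases hb : ∃ v : Fin 3 → ℤ, v ≠ 0 ∧ Sh a b δ (Real.exp (t i)) v s
      · exact Or.inr ⟨hs, hb⟩
      · refine Or.inl ⟨hs, ?_⟩
        rw [orbit_eq]
        apply hKg
        intro v hv
        by_contra hlt
        exact hb ⟨v, hv, (norm_lt_iff_Sh a b (t i) s δ hδ v).1 (not_le.1 hlt)⟩
    have hm := (measure_mono (μ := volume) hcov).trans (measure_union_le _ _)
    have hlow := (gt_low a b s₁ s₂ (t i) K).trans hi
    set G1 := volume {s | s ∈ Set.Icc s₁ s₂ ∧ gSL (t i) • phiSL a b s • x₀ ∈ K}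
    rw [Real.volume_Icc] at hm hlow
    have hle0 : ENNReal.ofReal (s₂ - s₁) ≠ 0 := by simpa using h
    rw [mul_comm, ← div_eq_mul_inv, ENNReal.div_le_iff hle0 ENNReal.ofReal_ne_top] at hlow
    have h3 := hm.trans (add_le_add hlow hvol)
    have e1 : ENNReal.ofReal (1 - ε) = ENNReal.ofReal (1 - ε') := by
      rcases le_total ε 1 with h1 | h1
      · rw [hε', min_eq_left h1]
      · rw [hε', min_eq_right h1, ENNReal.ofReal_of_nonpos (by linarith)]; simp
    have h1' : ε' ≤ 1 := min_le_right _ _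
    rw [e1, ← ENNReal.ofReal_mul (by linarith), ← ENNReal.ofReal_add (mul_nonneg (by linarith) hl.le) (by positivity)] at h3
    rw [ENNReal.ofReal_le_ofReal_iff (add_nonneg (mul_nonneg (by linarith) hl.le) (by positivity))] at h3
    nlinarith
  · intro v hv h1 h2
    have hs := hno v hv
    have hne : Nonempty (Set.Icc s₁ s₂) := ⟨⟨s₁, le_rfl, h.le⟩⟩
    have hlt : ρ < supNormOrbit a b s₁ s₂ (t i) v := by
      have : ρ ≤ δ₀ / 2 := min_le_left _ _
      linarith
    obtain ⟨s, hs'⟩ := exists_lt_of_lt_ciSup hlt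
    refine ⟨s, s.2, ?_⟩
    by_contra hc
    rw [not_le] at hc
    apply absurd hs'
    rw [not_lt]
    refine ((norm_lt_iff_Sh a b (t i) s ρ hρ v).2 ⟨hc, ?_, ?_⟩).le
    · exact h1.trans_le (by gcongr; linarith)
    · exact h2.trans_le (by gcongr; linarith)

/-- **Proposition (divergence criterion).** For `t_i → ∞`, the following are
equivalent: (1) for every compact `K ⊆ X`, eventually `g_{t_i} φ_{a,b}(s)·x₀ ∉ K` for
all `s ∈ I`; (2) there is `ε > 0` such that for every compact `K ⊆ X`, eventually
`(g_{t_i} λ_{a,b})(K) ≤ 1−ε`; (3) there are `v_i ∈ ℤ³ \ {0}` with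
`sup_{s∈I} ‖g_{t_i} φ_{a,b}(s) v_i‖ → 0`. -/
theorem divergence_tfae (a b s₁ s₂ : ℝ) (h : s₁ < s₂)
    (t : ℕ → ℝ) (ht : Tendsto t atTop atTop) :
    List.TFAE
      [ (∀ K : Set X, IsCompact K →
          ∀ᶠ i in atTop, ∀ s ∈ Set.Icc s₁ s₂, gSL (t i) • phiSL a b s • x₀ ∉ K),
        (∃ ε : ℝ, 0 < ε ∧ ∀ K : Set X, IsCompact K →
          ∀ᶠ i in atTop, gtLambda a b s₁ s₂ (t i) K ≤ ENNReal.ofReal (1 - ε)),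
        (∃ v : ℕ → Fin 3 → ℤ, (∀ i, v i ≠ 0) ∧
          Tendsto (fun i => supNormOrbit a b s₁ s₂ (t i) (v i)) atTop (𝓝 0)) ] := by
  tfae_have 3 → 1 := by
    rintro ⟨v, hv, hlim⟩ K hK
    obtain ⟨V, -, hKV, δ, hδ, hVg⟩ := compact_low K hK
    filter_upwards [hlim.eventually (gt_mem_nhds hδ)] with i hi s hs hmem
    rw [orbit_eq] at hmem
    have h1 := hVg _ (hKV hmem) (v i) (hv i)
    have h2 := le_ciSup (bddAbove_orbit a b s₁ s₂ (t i) (v i)) ⟨s, hs⟩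
    have h3 : δ ≤ supNormOrbit a b s₁ s₂ (t i) (v i) := h1.trans h2
    linarith
  tfae_have 1 → 2 := by
    intro H
    refine ⟨1, one_pos, fun K hK => ?_⟩
    obtain ⟨V, hVo, hKV, δ, hδ, hVg⟩ := compact_low K hK
    obtain ⟨K', hK', hKg⟩ := mahler_cpt δ hδ
    filter_upwards [H K' hK'] with i hi
    refine (measure_mono hKV).trans ?_
    rw [gt_open a b s₁ s₂ (t i) V hVo]
    · exact zero_le
    · intro s hs hmem
      apply hi s hs
      rw [orbit_eq] at hmem ⊢
      exact hKg _ (hVg _ hmem)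
  tfae_have 2 → 3 := by
    rintro ⟨ε, hε, H⟩
    have key := imp_2_3 a b s₁ s₂ h t ht ε hε H
    have hne : Nonempty {v : Fin 3 → ℤ // v ≠ 0} := ⟨⟨Pi.single 0 1, by simp⟩⟩
    have hch : ∀ i : ℕ, ∃ v : {v : Fin 3 → ℤ // v ≠ 0}, supNormOrbit a b s₁ s₂ (t i) v.1 <
        (⨅ v : {v : Fin 3 → ℤ // v ≠ 0}, supNormOrbit a b s₁ s₂ (t i) v.1) + 1 / ((i : ℝ) + 1) := by
      intro i
      apply exists_lt_of_ciInf_lt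
      have : (0:ℝ) < 1 / ((i : ℝ) + 1) := by positivity
      linarith
    choose v hv using hch
    refine ⟨fun i => (v i).1, fun i => (v i).2, ?_⟩
    rw [Metric.tendsto_atTop']
    have h1 : ∀ δ > 0, ∀ᶠ i in atTop, supNormOrbit a b s₁ s₂ (t i) (v i).1 < δ := by
      intro δ hδ
      have hs := (tendsto_one_div_add_atTop_nhds_zero_nat (𝕜 := ℝ)).eventually (gt_mem_nhds (half_pos hδ))
      filter_upwards [key (δ / 2) (half_pos hδ), hs] with i ⟨w, hw, hws⟩ hi
      have h2 := ciInf_le (f := fun v : {v : Fin 3 → ℤ // v ≠ 0} => supNormOrbit a b s₁ s₂ (t i) v.1)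
        ⟨0, by rintro _ ⟨x, rfl⟩; exact sup_nonneg _ _ _ _ _ _⟩ ⟨w, hw⟩
      have := hv i
      simp only at h2
      linarith
    intro δ hδ
    obtain ⟨N, hN⟩ := eventually_atTop.1 (h1 δ hδ)
    refine ⟨N, fun n hn => ?_⟩
    rw [Real.dist_eq, sub_zero, abs_of_nonneg (sup_nonneg _ _ _ _ _ _)]
    exact hN n hn.le
  tfae_finish
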